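/- arXiv:2303.11495 — 7 statements merged into one kernel-verified Lean document; each statement's English description precedes it below -/
import Mathlib

section
/- Suppose h, u solve the linearized Serre equations on [x_L, x_R] × [0, ∞). Then for every t ≥ 0 the energy satisfies dE/dt(t) = BT(h,u)(x_R, t) − BT(h,u)(x_L, t). -/
open Real MeasureTheory Set

noncomputable section

/-- Partial derivative in the spatial variable `x` (first argument). -/
def pdX (f : ℝ → ℝ → ℝ) (x t : ℝ) : ℝ := deriv (fun ξ => f ξ t) x

/-- Partial derivative in the temporal variable `t` (second argument). -/
def pdT (f : ℝ → ℝ → ℝ) (x t : ℝ) : ℝ := deriv (fun τ => f x τ) t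

/-- `h, u` solve the linearized Serre equations on `[xL, xR] × [0, ∞)`:
they are sufficiently smooth and satisfy the continuity and momentum equations. -/
def SolvesSerre (g H U xL xR : ℝ) (h u : ℝ → ℝ → ℝ) : Prop :=
  ContDiff ℝ 3 (fun p : ℝ × ℝ => h p.1 p.2) ∧
  ContDiff ℝ 3 (fun p : ℝ × ℝ => u p.1 p.2) ∧
  (∀ x ∈ Set.Icc xL xR, ∀ t : ℝ, 0 ≤ t →
    pdT h x t + pdX (fun ξ τ => H * u ξ τ + U * h ξ τ) x t = 0) ∧
  (∀ x ∈ Set.Icc xL xR, ∀ t : ℝ, 0 ≤ t →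
    pdT u x t + pdX (fun ξ τ => g * h ξ τ + U * u ξ τ
      - H ^ 2 * U / 3 * pdX (pdX u) ξ τ
      - H ^ 2 / 3 * pdT (pdX u) ξ τ) x t = 0)

/-- The energy `E(t)` on the interval `[xL, xR]`. -/
def energy (g H xL xR : ℝ) (h u : ℝ → ℝ → ℝ) (t : ℝ) : ℝ :=
  g / 2 * (∫ x in xL..xR, h x t ^ 2)
    + H / 2 * (∫ x in xL..xR, u x t ^ 2)
    + H ^ 3 / 6 * (∫ x in xL..xR, pdX u x t ^ 2)

/-- The boundary term `BT(h, u)(x, t)`. -/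
def BT (g H U : ℝ) (h u : ℝ → ℝ → ℝ) (x t : ℝ) : ℝ :=
  -(g * H) * h x t * u x t - g * U / 2 * h x t ^ 2 - H * U / 2 * u x t ^ 2
    - H ^ 3 * U / 6 * pdX u x t ^ 2
    + H ^ 3 * U / 3 * (u x t * pdX (pdX u) x t)
    + H ^ 3 / 3 * (u x t * pdT (pdX u) x t)

section PartialDerivatives

variable {f : ℝ → ℝ → ℝ}

lemma hasDerivAt_slice_left (hf : Differentiable ℝ (fun p : ℝ × ℝ => f p.1 p.2)) (x t : ℝ) :
    HasDerivAt (fun ξ => f ξ t) (fderiv ℝ (fun p : ℝ × ℝ => f p.1 p.2) (x, t) (1, 0)) x :=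
  HasFDerivAt.comp_hasDerivAt (l := (fun p : ℝ × ℝ => f p.1 p.2)) x (hf (x, t)).hasFDerivAt
    ((hasDerivAt_id' x).prodMk (hasDerivAt_const x t))

lemma hasDerivAt_slice_right (hf : Differentiable ℝ (fun p : ℝ × ℝ => f p.1 p.2)) (x t : ℝ) :
    HasDerivAt (fun τ => f x τ) (fderiv ℝ (fun p : ℝ × ℝ => f p.1 p.2) (x, t) (0, 1)) t :=
  HasFDerivAt.comp_hasDerivAt (l := (fun p : ℝ × ℝ => f p.1 p.2)) t (hf (x, t)).hasFDerivAt
    ((hasDerivAt_const t x).prodMk (hasDerivAt_id' t))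

lemma hasDerivAt_pdX (hf : Differentiable ℝ (fun p : ℝ × ℝ => f p.1 p.2)) (x t : ℝ) :
    HasDerivAt (fun ξ => f ξ t) (pdX f x t) x :=
  (hasDerivAt_slice_left hf x t).differentiableAt.hasDerivAt

lemma hasDerivAt_pdT (hf : Differentiable ℝ (fun p : ℝ × ℝ => f p.1 p.2)) (x t : ℝ) :
    HasDerivAt (fun τ => f x τ) (pdT f x t) t :=
  (hasDerivAt_slice_right hf x t).differentiableAt.hasDerivAt

lemma contDiff_pdX {n : ℕ} (hf : ContDiff ℝ (n + 1) (fun p : ℝ × ℝ => f p.1 p.2)) :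
    ContDiff ℝ n (fun p : ℝ × ℝ => pdX f p.1 p.2) := by
  have h_eq : (fun p : ℝ × ℝ => pdX f p.1 p.2) =
      fun p => fderiv ℝ (fun p : ℝ × ℝ => f p.1 p.2) p (1, 0) :=
    funext fun p => (hasDerivAt_slice_left (hf.differentiable (by simp)) p.1 p.2).deriv
  rw [h_eq]
  exact (hf.fderiv_right le_rfl).clm_apply contDiff_const

lemma contDiff_pdT {n : ℕ} (hf : ContDiff ℝ (n + 1) (fun p : ℝ × ℝ => f p.1 p.2)) :
    ContDiff ℝ n (fun p : ℝ × ℝ => pdT f p.1 p.2) := by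
  have h_eq : (fun p : ℝ × ℝ => pdT f p.1 p.2) =
      fun p => fderiv ℝ (fun p : ℝ × ℝ => f p.1 p.2) p (0, 1) :=
    funext fun p => (hasDerivAt_slice_right (hf.differentiable (by simp)) p.1 p.2).deriv
  rw [h_eq]
  exact (hf.fderiv_right le_rfl).clm_apply contDiff_const

end PartialDerivatives

/-- Differentiation under the integral sign when the integrand and its derivative in the parameter
are jointly continuous. -/
lemma hasDerivAt_intervalIntegral_of_continuous {F F' : ℝ → ℝ → ℝ} (a b t : ℝ)
    (hF : Continuous (fun p : ℝ × ℝ => F p.1 p.2))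
    (hF' : Continuous (fun p : ℝ × ℝ => F' p.1 p.2))
    (hderiv : ∀ x τ, HasDerivAt (fun τ => F x τ) (F' x τ) τ) :
    HasDerivAt (fun τ => ∫ x in a..b, F x τ) (∫ x in a..b, F' x t) t := by
  have h_slice {G : ℝ → ℝ → ℝ} (hG : Continuous (fun p : ℝ × ℝ => G p.1 p.2)) (τ : ℝ) :
      Continuous (fun x => G x τ) := hG.comp (Continuous.prodMk_left τ)
  obtain ⟨C, hC⟩ := (isCompact_uIcc.prod (isCompact_closedBall t 1)).exists_bound_of_continuousOn
    (s := uIcc a b ×ˢ Metric.closedBall t 1) hF'.continuousOn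
  exact (intervalIntegral.hasDerivAt_integral_of_dominated_loc_of_deriv_le
    (F := fun τ x => F x τ) (F' := fun τ x => F' x τ) (bound := fun _ => C)
    (Metric.closedBall_mem_nhds t one_pos)
    (.of_forall fun τ => (h_slice hF τ).aestronglyMeasurable)
    ((h_slice hF t).intervalIntegrable a b)
    (h_slice hF' t).aestronglyMeasurable
    (.of_forall fun x hx τ hτ => hC (x, τ) ⟨uIoc_subset_uIcc hx, hτ⟩)
    intervalIntegrable_const
    (.of_forall fun x _ τ _ => hderiv x τ)).2

lemma hasDerivAt_intervalIntegral_sq {f : ℝ → ℝ → ℝ} (a b t : ℝ)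
    (hf : ContDiff ℝ 1 (fun p : ℝ × ℝ => f p.1 p.2)) :
    HasDerivAt (fun τ => ∫ x in a..b, f x τ ^ 2) (∫ x in a..b, 2 * f x t * pdT f x t) t := by
  have hft : Continuous (fun p : ℝ × ℝ => pdT f p.1 p.2) :=
    (contDiff_pdT (n := 0) (by simpa using hf)).continuous
  refine hasDerivAt_intervalIntegral_of_continuous (F := fun x τ => f x τ ^ 2)
    (F' := fun x τ => 2 * f x τ * pdT f x τ) a b t (hf.continuous.pow 2)
    ((hf.continuous.const_mul 2).mul hft) fun x τ => ?_
  exact ((hasDerivAt_pdT (hf.differentiable one_ne_zero) x τ).pow 2).congr_deriv (by simp)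

/-- Lemma 3.2: the rate of change of the energy equals the boundary terms. -/
theorem energy_rate (g H U xL xR : ℝ) (hg : 0 < g) (hH : 0 < H) (hx : xL < xR)
    (h u : ℝ → ℝ → ℝ) (hsol : SolvesSerre g H U xL xR h u) :
    ∀ t : ℝ, 0 ≤ t →
      HasDerivWithinAt (energy g H xL xR h u)
        (BT g H U h u xR t - BT g H U h u xL t) (Set.Ici 0) t := by
  intro t ht
  obtain ⟨hh, hu, h_mass, h_mom⟩ := hsol
  have hux : ContDiff ℝ 2 (fun p : ℝ × ℝ => pdX u p.1 p.2) :=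
    contDiff_pdX (n := 2) (by norm_num; exact hu)
  have huxx : ContDiff ℝ 1 (fun p : ℝ × ℝ => pdX (pdX u) p.1 p.2) :=
    contDiff_pdX (n := 1) (by norm_num; exact hux)
  have huxt : ContDiff ℝ 1 (fun p : ℝ × ℝ => pdT (pdX u) p.1 p.2) :=
    contDiff_pdT (n := 1) (by norm_num; exact hux)
  have h_energy := (((hasDerivAt_intervalIntegral_sq xL xR t (hh.of_le (by norm_num))).const_mul
    (g / 2)).add ((hasDerivAt_intervalIntegral_sq xL xR t (hu.of_le (by norm_num))).const_mul
    (H / 2))).add ((hasDerivAt_intervalIntegral_sq xL xR t (hux.of_le (by norm_num))).const_mul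
    (H ^ 3 / 6))
  refine (h_energy.congr_deriv ?_).hasDerivWithinAt
  have h_int {f : ℝ → ℝ → ℝ} (hf : ContDiff ℝ 1 (fun p : ℝ × ℝ => f p.1 p.2)) :
      IntervalIntegrable (fun x => 2 * f x t * pdT f x t) volume xL xR := by
    have hft : Continuous (fun p : ℝ × ℝ => pdT f p.1 p.2) :=
      (contDiff_pdT (n := 0) (by simpa using hf)).continuous
    exact (((hf.continuous.const_mul 2).mul hft).comp
      (Continuous.prodMk_left t)).intervalIntegrable xL xR
  have h_int_h := (h_int (hh.of_le (by norm_num))).const_mul (g / 2)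
  have h_int_u := (h_int (hu.of_le (by norm_num))).const_mul (H / 2)
  have h_int_ux := (h_int (hux.of_le (by norm_num))).const_mul (H ^ 3 / 6)
  rw [← intervalIntegral.integral_const_mul, ← intervalIntegral.integral_const_mul,
    ← intervalIntegral.integral_const_mul, ← intervalIntegral.integral_add h_int_h h_int_u,
    ← intervalIntegral.integral_add (h_int_h.add h_int_u) h_int_ux]
  refine intervalIntegral.integral_eq_sub_of_hasDerivAt (f := fun x => BT g H U h u x t)
    (fun x hx_mem => ?_) ((h_int_h.add h_int_u).add h_int_ux)
  rw [uIcc_of_le hx.le] at hx_mem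
  have dh := hasDerivAt_pdX (hh.differentiable (by norm_num)) x t
  have du := hasDerivAt_pdX (hu.differentiable (by norm_num)) x t
  have dux := hasDerivAt_pdX (hux.differentiable (by norm_num)) x t
  have duxx := hasDerivAt_pdX (huxx.differentiable (by norm_num)) x t
  have duxt := hasDerivAt_pdX (huxt.differentiable (by norm_num)) x t
  have h_mass_x : pdT h x t + (H * pdX u x t + U * pdX h x t) = 0 := by
    rw [← h_mass x hx_mem t ht]
    exact congrArg _ ((du.const_mul H).add (dh.const_mul U)).deriv.symm
  have h_mom_x : pdT u x t + (g * pdX h x t + U * pdX u x t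
      - H ^ 2 * U / 3 * pdX (pdX (pdX u)) x t - H ^ 2 / 3 * pdX (pdT (pdX u)) x t) = 0 := by
    rw [← h_mom x hx_mem t ht]
    exact congrArg _ ((((dh.const_mul g).add (du.const_mul U)).sub
      (duxx.const_mul (H ^ 2 * U / 3))).sub (duxt.const_mul (H ^ 2 / 3))).deriv.symm
  have d_BT := ((((((dh.const_mul (-(g * H))).mul du).sub ((dh.pow 2).const_mul (g * U / 2))).sub
    ((du.pow 2).const_mul (H * U / 2))).sub ((dux.pow 2).const_mul (H ^ 3 * U / 6))).add
    ((du.mul duxx).const_mul (H ^ 3 * U / 3))).add ((du.mul duxt).const_mul (H ^ 3 / 3))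
  refine d_BT.congr_deriv ?_
  simp only [Nat.cast_ofNat, Nat.add_one_sub_one, pow_one]
  linear_combination (-g * h x t) * h_mass_x - H * u x t * h_mom_x
end
end

section
/- Let g, H > 0 and U > 0, and let λ₂, λ₃, λ₄, λ₅ be as defined from g, H, U. Let α₂, α₃, α₄, β₂, β₃, β₄ be real numbers, and let R be the symmetric 3×3 real matrix with rows [λ₂+β₂²λ₅, β₂β₃λ₅, β₂β₄λ₅], [β₂β₃λ₅, λ₃+β₃²λ₅, β₃β₄λ₅], [β₂β₄λ₅, β₃β₄λ₅, λ₄+β₄²λ₅]. Assume vᵀR v ≤ 0 for all v ∈ ℝ³ and λ₂α₂² + λ₃α₃² + λ₄α₄² + λ₅ ≥ 0. Let a₂, a₃, a₄, a₅ and b₂, b₃, b₄, b₅ be real numbers with a_j = α_j·a₅ for j = 2, 3, 4 and b₅ = β₂·b₂ + β₃·b₃ + β₄·b₄. Then Σ_{j=2}^{5} λ_j·b_j² − Σ_{j=2}^{5} λ_j·a_j² ≤ 0. -/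
open Matrix

noncomputable section

def lam2 (H U : ℝ) : ℝ := -(H ^ 3 * U) / 6
def lam3 (g U : ℝ) : ℝ := -(g * U) / 2
def lam4 (H U : ℝ) : ℝ := -(H * U) / 4 - H * Real.sqrt (4 * H ^ 4 + 9 * U ^ 2) / 12
def lam5 (H U : ℝ) : ℝ := -(H * U) / 4 + H * Real.sqrt (4 * H ^ 4 + 9 * U ^ 2) / 12

/-- Lemma 3.6 (algebraic content): with the inflow/outflow boundary conditions and
the matrix `R` negative semidefinite, the boundary term is nonpositive. -/
theorem boundary_term_nonpos_U_pos (g H U : ℝ) (hg : 0 < g) (hH : 0 < H) (hU : 0 < U)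
    (α₂ α₃ α₄ β₂ β₃ β₄ : ℝ)
    (hR : ∀ v : Fin 3 → ℝ,
      v ⬝ᵥ ((!![lam2 H U + β₂ ^ 2 * lam5 H U, β₂ * β₃ * lam5 H U, β₂ * β₄ * lam5 H U;
              β₂ * β₃ * lam5 H U, lam3 g U + β₃ ^ 2 * lam5 H U, β₃ * β₄ * lam5 H U;
              β₂ * β₄ * lam5 H U, β₃ * β₄ * lam5 H U, lam4 H U + β₄ ^ 2 * lam5 H U]) *ᵥ v)
        ≤ 0)
    (hα : lam2 H U * α₂ ^ 2 + lam3 g U * α₃ ^ 2 + lam4 H U * α₄ ^ 2 + lam5 H U ≥ 0)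
    (a₂ a₃ a₄ a₅ b₂ b₃ b₄ b₅ : ℝ)
    (ha₂ : a₂ = α₂ * a₅) (ha₃ : a₃ = α₃ * a₅) (ha₄ : a₄ = α₄ * a₅)
    (hb₅ : b₅ = β₂ * b₂ + β₃ * b₃ + β₄ * b₄) :
    (lam2 H U * b₂ ^ 2 + lam3 g U * b₃ ^ 2 + lam4 H U * b₄ ^ 2 + lam5 H U * b₅ ^ 2)
      - (lam2 H U * a₂ ^ 2 + lam3 g U * a₃ ^ 2 + lam4 H U * a₄ ^ 2 + lam5 H U * a₅ ^ 2)
      ≤ 0 := by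
  have hb := hR ![b₂, b₃, b₄]
  have ha := mul_nonneg hα (sq_nonneg a₅)
  simp only [Matrix.mulVec, dotProduct, Fin.sum_univ_three, Matrix.of_apply, Matrix.cons_val] at hb
  subst ha₂ ha₃ ha₄ hb₅
  linarith
end
end

section
/- Under the SBP assumptions, for all u, v ∈ ℝⁿ: ⟨u, D³v⟩_M = uₙ·(D²v)ₙ − u₁·(D²v)₁ − (1/2)·((Du)ₙ·(Dv)ₙ − (Du)₁·(Dv)₁) + (1/2)·⟨D²u, Dv⟩_M − (1/2)·⟨Du, D²v⟩_M. In particular, taking v = u: ⟨u, D³u⟩_M = uₙ·(D²u)ₙ − u₁·(D²u)₁ − (1/2)·(Du)ₙ² + (1/2)·(Du)₁². -/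
open Matrix

noncomputable section

/-- The SBP boundary matrix `B = diag(-1, 0, …, 0, 1)` in dimension `n + 2`. -/
def Bbnd (n : ℕ) : Matrix (Fin (n + 2)) (Fin (n + 2)) ℝ :=
  Matrix.diagonal (fun i => if i = 0 then (-1 : ℝ) else if i = Fin.last (n + 1) then 1 else 0)

/-- Discrete integration by parts: `⟨u, D w⟩_M = uₙ wₙ - u₁ w₁ - ⟨D u, w⟩_M`. -/
theorem sbp_dotProduct (n : ℕ) {M D : Matrix (Fin (n + 2)) (Fin (n + 2)) ℝ}
    (hSBP : M * D + Dᵀ * M = Bbnd n) (u w : Fin (n + 2) → ℝ) :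
    (D *ᵥ w) ⬝ᵥ (M *ᵥ u)
      = u (Fin.last (n + 1)) * w (Fin.last (n + 1)) - u 0 * w 0
        - w ⬝ᵥ (M *ᵥ (D *ᵥ u)) := by
  have hadj : (D *ᵥ w) ⬝ᵥ (M *ᵥ u) = w ⬝ᵥ ((Dᵀ * M) *ᵥ u) := by
    rw [← mulVec_mulVec, dotProduct_mulVec w, vecMul_transpose]
  have hB : w ⬝ᵥ (Bbnd n *ᵥ u)
      = u (Fin.last (n + 1)) * w (Fin.last (n + 1)) - u 0 * w 0 := by
    simp only [Bbnd, dotProduct, mulVec_diagonal]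
    rw [Fin.sum_univ_succ, Fin.sum_univ_castSucc]
    simp [Fin.ext_iff, (Fin.is_lt _).ne]
    ring
  rw [hadj, eq_sub_of_add_eq' hSBP, sub_mulVec, dotProduct_sub, hB, mulVec_mulVec]

/-- The SBP property for the third derivative, with `⟨u, v⟩_M = vᵀ M u`, and the
particular case `v = u`. -/
theorem sbp_third_derivative (n : ℕ) (M D : Matrix (Fin (n + 2)) (Fin (n + 2)) ℝ)
    (d : Fin (n + 2) → ℝ) (hM : M = Matrix.diagonal d) (hd : ∀ i, 0 < d i)
    (hSBP : M * D + Dᵀ * M = Bbnd n) :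
    (∀ u v : Fin (n + 2) → ℝ,
      ((D ^ 3) *ᵥ v) ⬝ᵥ (M *ᵥ u)
        = u (Fin.last (n + 1)) * ((D ^ 2) *ᵥ v) (Fin.last (n + 1))
            - u 0 * ((D ^ 2) *ᵥ v) 0
          - 1 / 2 * ((D *ᵥ u) (Fin.last (n + 1)) * (D *ᵥ v) (Fin.last (n + 1))
            - (D *ᵥ u) 0 * (D *ᵥ v) 0)
          + 1 / 2 * ((D *ᵥ v) ⬝ᵥ (M *ᵥ ((D ^ 2) *ᵥ u)))
          - 1 / 2 * (((D ^ 2) *ᵥ v) ⬝ᵥ (M *ᵥ (D *ᵥ u)))) ∧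
    (∀ u : Fin (n + 2) → ℝ,
      ((D ^ 3) *ᵥ u) ⬝ᵥ (M *ᵥ u)
        = u (Fin.last (n + 1)) * ((D ^ 2) *ᵥ u) (Fin.last (n + 1))
            - u 0 * ((D ^ 2) *ᵥ u) 0
          - 1 / 2 * (D *ᵥ u) (Fin.last (n + 1)) ^ 2
          + 1 / 2 * (D *ᵥ u) 0 ^ 2) := by
  have hsymm : ∀ x y : Fin (n + 2) → ℝ, x ⬝ᵥ (M *ᵥ y) = y ⬝ᵥ (M *ᵥ x) := by
    intro x y
    rw [dotProduct_mulVec, ← mulVec_transpose, hM, diagonal_transpose, dotProduct_comm]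
  have hsq : ∀ v : Fin (n + 2) → ℝ, (D ^ 2) *ᵥ v = D *ᵥ (D *ᵥ v) := by
    intro v
    rw [pow_two, mulVec_mulVec]
  have hcube : ∀ v : Fin (n + 2) → ℝ, (D ^ 3) *ᵥ v = D *ᵥ (D *ᵥ (D *ᵥ v)) := by
    intro v
    rw [pow_succ', ← mulVec_mulVec, hsq]
  simp only [hsq, hcube]
  refine ⟨fun u v => ?_, fun u => ?_⟩
  · linarith [sbp_dotProduct n hSBP u (D *ᵥ (D *ᵥ v)), sbp_dotProduct n hSBP (D *ᵥ u) (D *ᵥ v)]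
  · linarith [sbp_dotProduct n hSBP u (D *ᵥ (D *ᵥ u)), sbp_dotProduct n hSBP (D *ᵥ u) (D *ᵥ u),
      hsymm (D *ᵥ u) (D *ᵥ (D *ᵥ u))]
end
end

section
/- Let K = 𝐌⁻¹B̃ and D̃ = 𝐃 − (1/2)K. Let g, H > 0 and U ∈ ℝ. Then for all 𝐡, 𝐮, 𝐰 ∈ ℝ²ⁿ the following matrix identities hold: (i) −𝐃(H𝐮 + U𝐡) + (1/2)H·K𝐮 + (1/2)U·K𝐡 = −D̃(H𝐮 + U𝐡); and (ii) −𝐃(g𝐡 + U𝐮 − (H²U/3)𝐃²𝐮 − (H²/3)𝐃𝐰) + (1/2)g·K𝐡 + (1/2)U·K𝐮 − (H²/6)(𝐃K + K𝐃)𝐰 + (H²/12)K²𝐰 − (H²U/6)(𝐃²K + 𝐃K𝐃 + K𝐃²)𝐮 + (H²U/12)(𝐃K² + K𝐃K + K²𝐃)𝐮 − (H²U/24)K³𝐮 = −D̃(g𝐡 + U𝐮 − (H²U/3)D̃²𝐮 − (H²/3)D̃𝐰). Consequently, the penalized DG scheme with penalty parameters τ₁₁ = τ₁₂ = τ₂₁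 = τ₂₂ = 1/2, γ₂₁ = γ₂₂ = σ₂₁ = σ₂₂ = σ₂₄ = −1/6, γ₂₃ = σ₂₃ = σ₂₅ = σ₂₆ = 1/12, σ₂₇ = −1/24 is equivalent to the scheme written with the penalized operator D̃. -/
open Matrix

noncomputable section

/-- The first coordinate vector `e_L = (1, 0, …, 0)ᵀ`. -/
def eVL (n : ℕ) : Fin (n + 2) → ℝ := fun i => if i = 0 then 1 else 0

/-- The last coordinate vector `e_R = (0, …, 0, 1)ᵀ`. -/
def eVR (n : ℕ) : Fin (n + 2) → ℝ := fun i => if i = Fin.last (n + 1) then 1 else 0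

/-- The block interface operator `B̃`. -/
def Btil (n : ℕ) : Matrix (Fin (n + 2) ⊕ Fin (n + 2)) (Fin (n + 2) ⊕ Fin (n + 2)) ℝ :=
  Matrix.fromBlocks (vecMulVec (eVR n) (eVR n)) (-vecMulVec (eVR n) (eVL n))
    (vecMulVec (eVL n) (eVR n)) (-vecMulVec (eVL n) (eVL n))

/-- The block diagonal matrix `diag(A, A)`. -/
def blk (n : ℕ) (A : Matrix (Fin (n + 2)) (Fin (n + 2)) ℝ) :
    Matrix (Fin (n + 2) ⊕ Fin (n + 2)) (Fin (n + 2) ⊕ Fin (n + 2)) ℝ :=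
  Matrix.fromBlocks A 0 0 A

/-- The penalized derivative operator `D̃ = 𝐃 − (1/2)·𝐌⁻¹B̃`. -/
def Dtil (n : ℕ) (M D : Matrix (Fin (n + 2)) (Fin (n + 2)) ℝ) :
    Matrix (Fin (n + 2) ⊕ Fin (n + 2)) (Fin (n + 2) ⊕ Fin (n + 2)) ℝ :=
  blk n D - (1 / 2 : ℝ) • ((blk n M)⁻¹ * Btil n)

/-- The block inner product `⟨a, b⟩_𝐌 = bᵀ 𝐌 a`. -/
def ipM (n : ℕ) (M : Matrix (Fin (n + 2)) (Fin (n + 2)) ℝ)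
    (a b : Fin (n + 2) ⊕ Fin (n + 2) → ℝ) : ℝ :=
  b ⬝ᵥ (blk n M *ᵥ a)

/-- Lemma 4.5 (rewriting of the interface penalty terms): with `K = 𝐌⁻¹B̃` and
`D̃ = 𝐃 − (1/2)K`, the penalized DG scheme with the stated penalty parameters
can be written using the penalized operator `D̃`. -/
theorem penalty_rewriting (n : ℕ) (M D : Matrix (Fin (n + 2)) (Fin (n + 2)) ℝ)
    (d : Fin (n + 2) → ℝ) (hM : M = Matrix.diagonal d) (hd : ∀ i, 0 < d i)
    (g H U : ℝ) (hg : 0 < g) (hH : 0 < H) :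
    (∀ hv uv : Fin (n + 2) ⊕ Fin (n + 2) → ℝ,
      -(blk n D *ᵥ (H • uv + U • hv))
          + (1 / 2 * H) • (((blk n M)⁻¹ * Btil n) *ᵥ uv)
          + (1 / 2 * U) • (((blk n M)⁻¹ * Btil n) *ᵥ hv)
        = -(Dtil n M D *ᵥ (H • uv + U • hv))) ∧
    (∀ hv uv wv : Fin (n + 2) ⊕ Fin (n + 2) → ℝ,
      -(blk n D *ᵥ (g • hv + U • uv - (H ^ 2 * U / 3) • ((blk n D ^ 2) *ᵥ uv)
            - (H ^ 2 / 3) • (blk n D *ᵥ wv)))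
          + (1 / 2 * g) • (((blk n M)⁻¹ * Btil n) *ᵥ hv)
          + (1 / 2 * U) • (((blk n M)⁻¹ * Btil n) *ᵥ uv)
          - (H ^ 2 / 6) • ((blk n D * ((blk n M)⁻¹ * Btil n)
              + ((blk n M)⁻¹ * Btil n) * blk n D) *ᵥ wv)
          + (H ^ 2 / 12) • ((((blk n M)⁻¹ * Btil n) ^ 2) *ᵥ wv)
          - (H ^ 2 * U / 6) • ((blk n D ^ 2 * ((blk n M)⁻¹ * Btil n)
              + blk n D * ((blk n M)⁻¹ * Btil n) * blk n D
              + ((blk n M)⁻¹ * Btil n) * blk n D ^ 2) *ᵥ uv)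
          + (H ^ 2 * U / 12) • ((blk n D * ((blk n M)⁻¹ * Btil n) ^ 2
              + ((blk n M)⁻¹ * Btil n) * blk n D * ((blk n M)⁻¹ * Btil n)
              + ((blk n M)⁻¹ * Btil n) ^ 2 * blk n D) *ᵥ uv)
          - (H ^ 2 * U / 24) • ((((blk n M)⁻¹ * Btil n) ^ 3) *ᵥ uv)
        = -(Dtil n M D *ᵥ (g • hv + U • uv
            - (H ^ 2 * U / 3) • ((Dtil n M D ^ 2) *ᵥ uv)
            - (H ^ 2 / 3) • (Dtil n M D *ᵥ wv)))) := by
  unfold Dtil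
  generalize blk n D = A
  generalize (blk n M)⁻¹ * Btil n = K
  constructor
  · intro hv uv
    simp only [sub_mulVec, smul_mulVec, mulVec_add, mulVec_smul]
    module
  · intro hv uv wv
    simp only [pow_succ, pow_zero, one_mul, ← mulVec_mulVec, sub_mulVec, add_mulVec, smul_mulVec,
      mulVec_add, mulVec_sub, mulVec_smul]
    module
end
end

section
/- Let g, H > 0, U ∈ ℝ, α_h, α_u ≥ 0, and suppose D·𝟙 = 0 where 𝟙 ∈ ℝⁿ is the all-ones vector. Let 𝐡, 𝐮 : [0, ∞) → ℝ²ⁿ be differentiable and satisfy the penalized semi-discrete scheme: 𝐡'(t) + D̃(H𝐮 + U𝐡) + α_h·𝐌⁻¹B̃ᵀB̃𝐡 = 0 and 𝐮'(t) + D̃(g𝐡 + U𝐮 − (H²U/3)D̃²𝐮 − (H²/3)D̃𝐮'(t)) + α_u·𝐌⁻¹B̃ᵀB̃𝐮 = 0. Write 𝐆(t) = g𝐡 + U𝐮 − (H²U/3)D̃²𝐮 − (H²/3)D̃𝐮'(t) = (G⁻, G⁺). Assume that for all t ≥ 0 the outer-boundary flux values agree: H·u⁺ₙ + U·h⁺ₙ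 = H·u⁻₁ + U·h⁻₁ and G⁺ₙ = G⁻₁. Then the discrete total mass and momentum are conserved: the functions t ↦ g·𝟙₂ₙᵀ𝐌𝐡(t) and t ↦ H·𝟙₂ₙᵀ𝐌𝐮(t) are constant, where 𝟙₂ₙ ∈ ℝ²ⁿ is the all-ones vector. -/
open Matrix

noncomputable section

lemma isUnit_det_blk {n : ℕ} {M : Matrix (Fin (n + 2)) (Fin (n + 2)) ℝ}
    (hM : IsUnit M.det) : IsUnit (blk n M).det := by
  rw [blk, det_fromBlocks_zero₂₁]
  exact hM.mul hM

lemma Btil_mulVec (n : ℕ) (x : Fin (n + 2) ⊕ Fin (n + 2) → ℝ) :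
    Btil n *ᵥ x = (x (Sum.inl (Fin.last (n + 1))) - x (Sum.inr 0)) •
      Sum.elim (eVR n) (eVL n) := by
  have hL (v : Fin (n + 2) → ℝ) : eVL n ⬝ᵥ v = v 0 := by simp [eVL, dotProduct]
  have hR (v : Fin (n + 2) → ℝ) : eVR n ⬝ᵥ v = v (Fin.last (n + 1)) := by
    simp [eVR, dotProduct]
  rw [Btil, fromBlocks_mulVec]
  ext i
  rcases i with i | i <;>
    simp [neg_mulVec, vecMulVec_mulVec, hL, hR] <;> ring

lemma one_dotProduct_Btil_mulVec (n : ℕ) (x : Fin (n + 2) ⊕ Fin (n + 2) → ℝ) :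
    (fun _ => (1 : ℝ)) ⬝ᵥ (Btil n *ᵥ x)
      = 2 * (x (Sum.inl (Fin.last (n + 1))) - x (Sum.inr 0)) := by
  rw [Btil_mulVec]
  simp [dotProduct, Fintype.sum_sum_type, eVL, eVR]
  ring

/-- Constant vectors have no jump at the interface. -/
lemma one_dotProduct_Btil_transpose_mulVec (n : ℕ) (x : Fin (n + 2) ⊕ Fin (n + 2) → ℝ) :
    (fun _ => (1 : ℝ)) ⬝ᵥ ((Btil n)ᵀ *ᵥ x) = 0 := by
  rw [dotProduct_mulVec, vecMul_transpose, Btil_mulVec]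
  simp

/-- The summation-by-parts property turns the mass of a derivative into a boundary term. -/
lemma one_dotProduct_mulVec_of_sbp {n : ℕ} {M D : Matrix (Fin (n + 2)) (Fin (n + 2)) ℝ}
    (hSBP : M * D + Dᵀ * M = Bbnd n) (hone : D *ᵥ (fun _ => (1 : ℝ)) = 0)
    (x : Fin (n + 2) → ℝ) :
    (fun _ => (1 : ℝ)) ⬝ᵥ (M *ᵥ (D *ᵥ x)) = x (Fin.last (n + 1)) - x 0 := by
  rw [mulVec_mulVec, eq_sub_of_add_eq hSBP, sub_mulVec, dotProduct_sub, ← mulVec_mulVec,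
    dotProduct_mulVec _ Dᵀ, vecMul_transpose, hone, zero_dotProduct, sub_zero]
  have hB (i : Fin (n + 2)) : (Bbnd n *ᵥ x) i
      = (if i = Fin.last (n + 1) then x i else 0) - if i = 0 then x i else 0 := by
    rw [Bbnd, mulVec_diagonal]
    by_cases h : i = 0
    · subst h
      simp [Fin.ext_iff]
    · simp [h]
  simp [dotProduct, hB]

lemma one_dotProduct_Dtil_mulVec {n : ℕ} {M D : Matrix (Fin (n + 2)) (Fin (n + 2)) ℝ}
    (hM : IsUnit M.det) (hSBP : M * D + Dᵀ * M = Bbnd n)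
    (hone : D *ᵥ (fun _ => (1 : ℝ)) = 0) (x : Fin (n + 2) ⊕ Fin (n + 2) → ℝ) :
    (fun _ => (1 : ℝ)) ⬝ᵥ (blk n M *ᵥ (Dtil n M D *ᵥ x))
      = x (Sum.inr (Fin.last (n + 1))) - x (Sum.inl 0) := by
  have hblk : (fun _ => (1 : ℝ)) ⬝ᵥ (blk n M *ᵥ (blk n D *ᵥ x))
      = (x (Sum.inl (Fin.last (n + 1))) - x (Sum.inl 0))
        + (x (Sum.inr (Fin.last (n + 1))) - x (Sum.inr 0)) := by
    have hl := one_dotProduct_mulVec_of_sbp hSBP hone (x ∘ Sum.inl)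
    have hr := one_dotProduct_mulVec_of_sbp hSBP hone (x ∘ Sum.inr)
    simp only [dotProduct, one_mul, Function.comp_apply] at hl hr
    simp [blk, fromBlocks_mulVec, dotProduct, Fintype.sum_sum_type, hl, hr, -mulVec_mulVec]
  rw [Dtil, sub_mulVec, mulVec_sub, dotProduct_sub, hblk, smul_mulVec, mulVec_smul,
    dotProduct_smul, mulVec_mulVec, mul_nonsing_inv_cancel_left _ _ (isUnit_det_blk hM),
    one_dotProduct_Btil_mulVec, smul_eq_mul]
  ring

lemma one_dotProduct_penalty_mulVec {n : ℕ} {M : Matrix (Fin (n + 2)) (Fin (n + 2)) ℝ}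
    (hM : IsUnit M.det) (x : Fin (n + 2) ⊕ Fin (n + 2) → ℝ) :
    (fun _ => (1 : ℝ)) ⬝ᵥ (blk n M *ᵥ (((blk n M)⁻¹ * (Btil n)ᵀ * Btil n) *ᵥ x)) = 0 := by
  rw [mulVec_mulVec, Matrix.mul_assoc, mul_nonsing_inv_cancel_left _ _ (isUnit_det_blk hM),
    ← mulVec_mulVec, one_dotProduct_Btil_transpose_mulVec]

/-- A penalized conservation law whose flux agrees at the two outer boundaries conserves
the discrete total mass. -/
lemma one_dotProduct_const_of_scheme {n : ℕ} {M D : Matrix (Fin (n + 2)) (Fin (n + 2)) ℝ}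
    (hM : IsUnit M.det) (hSBP : M * D + Dᵀ * M = Bbnd n)
    (hone : D *ᵥ (fun _ => (1 : ℝ)) = 0) (a : ℝ)
    (y F : ℝ → Fin (n + 2) ⊕ Fin (n + 2) → ℝ) (hy : Differentiable ℝ y)
    (hscheme : ∀ t : ℝ, 0 ≤ t → deriv y t + Dtil n M D *ᵥ F t
      + a • (((blk n M)⁻¹ * (Btil n)ᵀ * Btil n) *ᵥ y t) = 0)
    (houter : ∀ t : ℝ, 0 ≤ t → F t (Sum.inr (Fin.last (n + 1))) = F t (Sum.inl 0))
    {t : ℝ} (ht : 0 ≤ t) :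
    (fun _ => (1 : ℝ)) ⬝ᵥ (blk n M *ᵥ y t) = (fun _ => (1 : ℝ)) ⬝ᵥ (blk n M *ᵥ y 0) := by
  have hzero (s : ℝ) (hs : 0 ≤ s) : (fun _ => (1 : ℝ)) ⬝ᵥ (blk n M *ᵥ deriv y s) = 0 := by
    have h := congrArg (fun v => (fun _ => (1 : ℝ)) ⬝ᵥ (blk n M *ᵥ v)) (hscheme s hs)
    simpa only [mulVec_add, dotProduct_add, one_dotProduct_Dtil_mulVec hM hSBP hone,
      houter s hs, sub_self, add_zero, mulVec_smul, dotProduct_smul,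
      one_dotProduct_penalty_mulVec hM, smul_zero, mulVec_zero, dotProduct_zero] using h
  have hderiv (s : ℝ) : HasDerivAt (fun r => (fun _ => (1 : ℝ)) ⬝ᵥ (blk n M *ᵥ y r))
      ((fun _ => (1 : ℝ)) ⬝ᵥ (blk n M *ᵥ deriv y s)) s := by
    have h := hasDerivAt_pi.1 (hy s).hasDerivAt
    simp only [dotProduct, mulVec]
    exact HasDerivAt.fun_sum fun i _ =>
      (HasDerivAt.fun_sum fun j _ => (h j).const_mul _).const_mul _
  exact constant_of_has_deriv_right_zero
    (fun s _ => (hderiv s).continuousAt.continuousWithinAt)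
    (fun s hs => hzero s hs.1 ▸ (hderiv s).hasDerivWithinAt) t ⟨ht, le_rfl⟩

/-- Theorem 4.6: the penalized semi-discrete scheme conserves the discrete total
mass and momentum (interface contributions only; the outer-boundary flux values
are assumed to agree). -/
theorem discrete_conservation (n : ℕ) (M D : Matrix (Fin (n + 2)) (Fin (n + 2)) ℝ)
    (d : Fin (n + 2) → ℝ) (hM : M = Matrix.diagonal d) (hd : ∀ i, 0 < d i)
    (hSBP : M * D + Dᵀ * M = Bbnd n)
    (g H U αh αu : ℝ) (hg : 0 < g) (hH : 0 < H) (hαh : 0 ≤ αh) (hαu : 0 ≤ αu)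
    (hone : D *ᵥ (fun _ => (1 : ℝ)) = 0)
    (hv uv : ℝ → Fin (n + 2) ⊕ Fin (n + 2) → ℝ)
    (hhv : Differentiable ℝ hv) (huv : Differentiable ℝ uv)
    (hschemeh : ∀ t : ℝ, 0 ≤ t →
      deriv hv t + Dtil n M D *ᵥ (H • uv t + U • hv t)
        + αh • (((blk n M)⁻¹ * (Btil n)ᵀ * Btil n) *ᵥ hv t) = 0)
    (hschemeu : ∀ t : ℝ, 0 ≤ t →
      deriv uv t + Dtil n M D *ᵥ (g • hv t + U • uv t
          - (H ^ 2 * U / 3) • ((Dtil n M D ^ 2) *ᵥ uv t)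
          - (H ^ 2 / 3) • (Dtil n M D *ᵥ deriv uv t))
        + αu • (((blk n M)⁻¹ * (Btil n)ᵀ * Btil n) *ᵥ uv t) = 0)
    (houterFh : ∀ t : ℝ, 0 ≤ t →
      H * uv t (Sum.inr (Fin.last (n + 1))) + U * hv t (Sum.inr (Fin.last (n + 1)))
        = H * uv t (Sum.inl 0) + U * hv t (Sum.inl 0))
    (houterFu : ∀ t : ℝ, 0 ≤ t →
      ((g • hv t + U • uv t - (H ^ 2 * U / 3) • ((Dtil n M D ^ 2) *ᵥ uv t)
          - (H ^ 2 / 3) • (Dtil n M D *ᵥ deriv uv t) : Fin (n + 2) ⊕ Fin (n + 2) → ℝ))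
            (Sum.inr (Fin.last (n + 1)))
        = ((g • hv t + U • uv t - (H ^ 2 * U / 3) • ((Dtil n M D ^ 2) *ᵥ uv t)
          - (H ^ 2 / 3) • (Dtil n M D *ᵥ deriv uv t) : Fin (n + 2) ⊕ Fin (n + 2) → ℝ))
            (Sum.inl 0)) :
    (∀ t : ℝ, 0 ≤ t →
      g * ((fun _ => (1 : ℝ)) ⬝ᵥ (blk n M *ᵥ hv t))
        = g * ((fun _ => (1 : ℝ)) ⬝ᵥ (blk n M *ᵥ hv 0))) ∧
    (∀ t : ℝ, 0 ≤ t →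
      H * ((fun _ => (1 : ℝ)) ⬝ᵥ (blk n M *ᵥ uv t))
        = H * ((fun _ => (1 : ℝ)) ⬝ᵥ (blk n M *ᵥ uv 0))) := by
  have hdet : IsUnit M.det := by
    rw [hM, det_diagonal]
    exact (Finset.prod_pos fun i _ => hd i).ne'.isUnit
  refine ⟨fun t ht => ?_, fun t ht => ?_⟩
  · rw [one_dotProduct_const_of_scheme hdet hSBP hone αh hv _ hhv hschemeh houterFh ht]
  · rw [one_dotProduct_const_of_scheme hdet hSBP hone αu uv _ huv hschemeu houterFu ht]
end
end

section
/- Let g, H > 0, U ∈ ℝ, α_h, α_u ≥ 0. Let 𝐡, 𝐮 : [0, ∞) → ℝ²ⁿ be differentiable and satisfy the penalized semi-discrete scheme: 𝐡'(t) + D̃(H𝐮 + U𝐡) + α_h·𝐌⁻¹B̃ᵀB̃𝐡 = 0 and 𝐮'(t) + D̃(g𝐡 + U𝐮 − (H²U/3)D̃²𝐮 − (H²/3)D̃𝐮'(t)) + α_u·𝐌⁻¹B̃ᵀB̃𝐮 = 0. Assume the solution vanishes at the outer boundary nodes for all t ≥ 0: h⁻₁ = h⁺ₙ = 0, u⁻₁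 = u⁺ₙ = 0, and (D u⁻)₁ = (D u⁺)ₙ = 0. Define the discrete energy E_𝐌(t) = (g/2)‖𝐡(t)‖²_𝐌 + (H/2)‖𝐮(t)‖²_𝐌 + (H³/6)‖D̃𝐮(t)‖²_𝐌. Then E_𝐌(t) ≤ E_𝐌(0) for all t ≥ 0; moreover, if α_h = α_u = 0 then E_𝐌(t) = E_𝐌(0) for all t ≥ 0. -/
open Matrix

noncomputable section

lemma isUnit_det_blk_diagonal {n : ℕ} {d : Fin (n + 2) → ℝ} (hd : ∀ i, 0 < d i) :
    IsUnit (blk n (diagonal d)).det := by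
  rw [blk, det_fromBlocks_zero₂₁, det_diagonal, isUnit_iff_ne_zero]
  exact mul_self_ne_zero.mpr (Finset.prod_ne_zero_iff.mpr fun i _ => (hd i).ne')

lemma transpose_blk_diagonal {n : ℕ} (d : Fin (n + 2) → ℝ) :
    (blk n (diagonal d))ᵀ = blk n (diagonal d) := by
  simp [blk]

lemma inv_blk_diagonal {n : ℕ} {d : Fin (n + 2) → ℝ} (hd : ∀ i, 0 < d i) :
    (blk n (diagonal d))⁻¹ = blk n (diagonal fun i => (d i)⁻¹) := by
  refine inv_eq_right_inv ?_
  simp only [blk, fromBlocks_multiply]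
  simp [fun i => mul_inv_cancel₀ (hd i).ne']

/-- Only the outer boundary nodes contribute to the SBP defect of `D̃`. -/
lemma blk_mul_Dtil_add_transpose {n : ℕ} {D : Matrix (Fin (n + 2)) (Fin (n + 2)) ℝ}
    {d : Fin (n + 2) → ℝ} (hd : ∀ i, 0 < d i)
    (hSBP : diagonal d * D + Dᵀ * diagonal d = Bbnd n) :
    blk n (diagonal d) * Dtil n (diagonal d) D + (blk n (diagonal d) * Dtil n (diagonal d) D)ᵀ
      = fromBlocks (-vecMulVec (eVL n) (eVL n)) 0 0 (vecMulVec (eVR n) (eVR n)) := by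
  have hB : Bbnd n = vecMulVec (eVR n) (eVR n) - vecMulVec (eVL n) (eVL n) := by
    ext i j
    have h0 : (0 : Fin (n + 2)) ≠ Fin.last (n + 1) := (Fin.last_pos).ne
    simp only [Bbnd, diagonal_apply, vecMulVec_apply, eVL, eVR, Matrix.sub_apply]
    split_ifs <;> simp_all
  have hQ : blk n (diagonal d) * Dtil n (diagonal d) D
      = blk n (diagonal d * D) - (1 / 2 : ℝ) • Btil n := by
    rw [Dtil, mul_sub, mul_smul_comm, mul_nonsing_inv_cancel_left _ _ (isUnit_det_blk_diagonal hd)]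
    simp only [blk, fromBlocks_multiply]
    simp
  have hS : Dᵀ * diagonal d = vecMulVec (eVR n) (eVR n) - vecMulVec (eVL n) (eVL n)
      - diagonal d * D := by
    rw [← hB, ← hSBP]; abel
  rw [hQ]
  simp only [blk, Btil, transpose_sub, transpose_smul, fromBlocks_transpose, transpose_mul,
    diagonal_transpose, hS, transpose_neg, transpose_vecMulVec, transpose_zero]
  ext (i | i) (j | j) <;> simp [vecMulVec_apply] <;> ring

section ipM

variable {n : ℕ} {M D : Matrix (Fin (n + 2)) (Fin (n + 2)) ℝ}

lemma ipM_add_left (a a' b : Fin (n + 2) ⊕ Fin (n + 2) → ℝ) :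
    ipM n M (a + a') b = ipM n M a b + ipM n M a' b := by
  simp [ipM, mulVec_add]

lemma ipM_sub_left (a a' b : Fin (n + 2) ⊕ Fin (n + 2) → ℝ) :
    ipM n M (a - a') b = ipM n M a b - ipM n M a' b := by
  simp [ipM, mulVec_sub]

lemma ipM_smul_left (c : ℝ) (a b : Fin (n + 2) ⊕ Fin (n + 2) → ℝ) :
    ipM n M (c • a) b = c * ipM n M a b := by
  simp [ipM, mulVec_smul]

lemma ipM_zero_left (b : Fin (n + 2) ⊕ Fin (n + 2) → ℝ) : ipM n M 0 b = 0 := by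
  simp [ipM]

lemma ipM_diagonal_comm (d : Fin (n + 2) → ℝ) (a b : Fin (n + 2) ⊕ Fin (n + 2) → ℝ) :
    ipM n (diagonal d) a b = ipM n (diagonal d) b a := by
  rw [ipM, ipM, dotProduct_mulVec, ← mulVec_transpose, transpose_blk_diagonal, dotProduct_comm]

/-- Discrete integration by parts for `D̃`. -/
lemma ipM_Dtil_add_ipM_Dtil {d : Fin (n + 2) → ℝ} (hd : ∀ i, 0 < d i)
    (hSBP : diagonal d * D + Dᵀ * diagonal d = Bbnd n)
    (a b : Fin (n + 2) ⊕ Fin (n + 2) → ℝ) :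
    ipM n (diagonal d) (Dtil n (diagonal d) D *ᵥ a) b
        + ipM n (diagonal d) (Dtil n (diagonal d) D *ᵥ b) a
      = b (Sum.inr (Fin.last (n + 1))) * a (Sum.inr (Fin.last (n + 1)))
        - b (Sum.inl 0) * a (Sum.inl 0) := by
  have key := congrArg (fun Q => b ⬝ᵥ (Q *ᵥ a)) (blk_mul_Dtil_add_transpose hd hSBP)
  simp only [add_mulVec, dotProduct_add] at key
  rw [mulVec_transpose, dotProduct_comm b (a ᵥ* _), ← dotProduct_mulVec] at key
  simp only [ipM, mulVec_mulVec]
  rw [key]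
  simp [dotProduct, Fintype.sum_sum_type, mulVec, vecMulVec_apply,
    eVL, eVR]
  ring

lemma ipM_inv_mul_Btil {d : Fin (n + 2) → ℝ} (hd : ∀ i, 0 < d i)
    (a : Fin (n + 2) ⊕ Fin (n + 2) → ℝ) :
    ipM n (diagonal d) (((blk n (diagonal d))⁻¹ * (Btil n)ᵀ * Btil n) *ᵥ a) a
      = (Btil n *ᵥ a) ⬝ᵥ (Btil n *ᵥ a) := by
  rw [ipM, mulVec_mulVec, Matrix.mul_assoc,
    mul_nonsing_inv_cancel_left _ _ (isUnit_det_blk_diagonal hd), ← mulVec_mulVec,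
    dotProduct_mulVec, vecMul_transpose]

lemma Dtil_diagonal_mulVec_inl_zero {d : Fin (n + 2) → ℝ} (hd : ∀ i, 0 < d i)
    (a : Fin (n + 2) ⊕ Fin (n + 2) → ℝ) :
    (Dtil n (diagonal d) D *ᵥ a) (Sum.inl 0) = (D *ᵥ fun i => a (Sum.inl i)) 0 := by
  rw [Dtil, inv_blk_diagonal hd]
  simp [blk, Btil, mulVec, dotProduct, diagonal_mul, vecMulVec_apply, eVL,
    eVR]

lemma Dtil_diagonal_mulVec_inr_last {d : Fin (n + 2) → ℝ} (hd : ∀ i, 0 < d i)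
    (a : Fin (n + 2) ⊕ Fin (n + 2) → ℝ) :
    (Dtil n (diagonal d) D *ᵥ a) (Sum.inr (Fin.last (n + 1)))
      = (D *ᵥ fun i => a (Sum.inr i)) (Fin.last (n + 1)) := by
  rw [Dtil, inv_blk_diagonal hd]
  simp [blk, Btil, mulVec, dotProduct, diagonal_mul, vecMulVec_apply, eVL,
    eVR]

lemma hasDerivAt_mulVec (A : Matrix (Fin (n + 2) ⊕ Fin (n + 2)) (Fin (n + 2) ⊕ Fin (n + 2)) ℝ)
    {f : ℝ → Fin (n + 2) ⊕ Fin (n + 2) → ℝ} {f' : Fin (n + 2) ⊕ Fin (n + 2) → ℝ} {t : ℝ}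
    (hf : HasDerivAt f f' t) : HasDerivAt (fun s => A *ᵥ f s) (A *ᵥ f') t :=
  (LinearMap.toContinuousLinearMap A.mulVecLin).hasFDerivAt.comp_hasDerivAt t hf

lemma hasDerivAt_ipM_self (d : Fin (n + 2) → ℝ)
    {f : ℝ → Fin (n + 2) ⊕ Fin (n + 2) → ℝ} {f' : Fin (n + 2) ⊕ Fin (n + 2) → ℝ} {t : ℝ}
    (hf : HasDerivAt f f' t) :
    HasDerivAt (fun s => ipM n (diagonal d) (f s) (f s)) (2 * ipM n (diagonal d) f' (f t)) t := by
  have hsum := HasDerivAt.fun_sum (u := Finset.univ) fun i _ =>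
    (hasDerivAt_pi.mp hf i).mul (hasDerivAt_pi.mp (hasDerivAt_mulVec (blk n (diagonal d)) hf) i)
  refine hsum.congr_deriv ?_
  rw [Finset.sum_add_distrib, two_mul]
  exact congrArg₂ (· + ·) (ipM_diagonal_comm d (f t) f') rfl

end ipM

/-- Theorem 4.7: the discrete energy of the penalized semi-discrete scheme is
nonincreasing (and conserved when the upwind parameters vanish), the outer
boundary contributions being assumed to vanish. -/
theorem discrete_energy_estimate (n : ℕ) (M D : Matrix (Fin (n + 2)) (Fin (n + 2)) ℝ)
    (d : Fin (n + 2) → ℝ) (hM : M = Matrix.diagonal d) (hd : ∀ i, 0 < d i)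
    (hSBP : M * D + Dᵀ * M = Bbnd n)
    (g H U αh αu : ℝ) (hg : 0 < g) (hH : 0 < H) (hαh : 0 ≤ αh) (hαu : 0 ≤ αu)
    (hv uv : ℝ → Fin (n + 2) ⊕ Fin (n + 2) → ℝ)
    (hhv : Differentiable ℝ hv) (huv : Differentiable ℝ uv)
    (hschemeh : ∀ t : ℝ, 0 ≤ t →
      deriv hv t + Dtil n M D *ᵥ (H • uv t + U • hv t)
        + αh • (((blk n M)⁻¹ * (Btil n)ᵀ * Btil n) *ᵥ hv t) = 0)
    (hschemeu : ∀ t : ℝ, 0 ≤ t →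
      deriv uv t + Dtil n M D *ᵥ (g • hv t + U • uv t
          - (H ^ 2 * U / 3) • ((Dtil n M D ^ 2) *ᵥ uv t)
          - (H ^ 2 / 3) • (Dtil n M D *ᵥ deriv uv t))
        + αu • (((blk n M)⁻¹ * (Btil n)ᵀ * Btil n) *ᵥ uv t) = 0)
    (hbd_h1 : ∀ t : ℝ, 0 ≤ t → hv t (Sum.inl 0) = 0)
    (hbd_h2 : ∀ t : ℝ, 0 ≤ t → hv t (Sum.inr (Fin.last (n + 1))) = 0)
    (hbd_u1 : ∀ t : ℝ, 0 ≤ t → uv t (Sum.inl 0) = 0)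
    (hbd_u2 : ∀ t : ℝ, 0 ≤ t → uv t (Sum.inr (Fin.last (n + 1))) = 0)
    (hbd_Du1 : ∀ t : ℝ, 0 ≤ t → (D *ᵥ (fun i => uv t (Sum.inl i))) 0 = 0)
    (hbd_Du2 : ∀ t : ℝ, 0 ≤ t →
      (D *ᵥ (fun i => uv t (Sum.inr i))) (Fin.last (n + 1)) = 0)
    (E : ℝ → ℝ)
    (hE : ∀ t : ℝ, E t = g / 2 * ipM n M (hv t) (hv t) + H / 2 * ipM n M (uv t) (uv t)
      + H ^ 3 / 6 * ipM n M (Dtil n M D *ᵥ uv t) (Dtil n M D *ᵥ uv t)) :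
    (∀ t : ℝ, 0 ≤ t → E t ≤ E 0) ∧
    (αh = 0 → αu = 0 → ∀ t : ℝ, 0 ≤ t → E t = E 0) := by
  subst hM
  have hskew := ipM_Dtil_add_ipM_Dtil (D := D) hd hSBP
  have hderiv : ∀ t, 0 ≤ t → HasDerivAt E
      (-(g * αh * ((Btil n *ᵥ hv t) ⬝ᵥ (Btil n *ᵥ hv t)))
        - H * αu * ((Btil n *ᵥ uv t) ⬝ᵥ (Btil n *ᵥ uv t))) t := by
    intro t ht
    have hh := (hhv t).hasDerivAt
    have hu := (huv t).hasDerivAt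
    have hsum := (((hasDerivAt_ipM_self d hh).const_mul (g / 2)).add
      ((hasDerivAt_ipM_self d hu).const_mul (H / 2))).add
      ((hasDerivAt_ipM_self d (hasDerivAt_mulVec (Dtil n (diagonal d) D) hu)).const_mul (H ^ 3 / 6))
    refine (hsum.congr_of_eventuallyEq (.of_forall hE)).congr_deriv ?_
    have eh := congrArg (fun v => ipM n (diagonal d) v (hv t)) (hschemeh t ht)
    have eu := congrArg (fun v => ipM n (diagonal d) v (uv t)) (hschemeu t ht)
    simp only [mulVec_add, mulVec_sub, mulVec_smul, ipM_add_left, ipM_sub_left, ipM_smul_left,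
      ipM_zero_left, ipM_inv_mul_Btil hd] at eh eu
    simp only [pow_two (Dtil n (diagonal d) D), ← mulVec_mulVec] at eu
    have s_hh := hskew (hv t) (hv t)
    have s_uh := hskew (uv t) (hv t)
    have s_uu := hskew (uv t) (uv t)
    have s_uDu' := hskew (Dtil n (diagonal d) D *ᵥ deriv uv t) (uv t)
    have s_uDDu := hskew (Dtil n (diagonal d) D *ᵥ Dtil n (diagonal d) D *ᵥ uv t) (uv t)
    have s_DuDu := hskew (Dtil n (diagonal d) D *ᵥ uv t) (Dtil n (diagonal d) D *ᵥ uv t)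
    rw [ipM_diagonal_comm d (Dtil n (diagonal d) D *ᵥ uv t)] at s_uDu' s_uDDu
    rw [Dtil_diagonal_mulVec_inl_zero hd, Dtil_diagonal_mulVec_inr_last hd, hbd_Du1 t ht,
      hbd_Du2 t ht] at s_DuDu
    rw [hbd_h1 t ht, hbd_h2 t ht] at s_hh s_uh
    rw [hbd_u1 t ht, hbd_u2 t ht] at s_uu s_uDu' s_uDDu
    linear_combination g * eh + H * eu - g * U / 2 * s_hh - g * H * s_uh - H * U / 2 * s_uu
      + H ^ 3 / 3 * s_uDu' + H ^ 3 * U / 3 * s_uDDu - H ^ 3 * U / 6 * s_DuDu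
  have hcont : ContinuousOn E (Set.Ici 0) := fun t ht =>
    (hderiv t ht).continuousAt.continuousWithinAt
  have hdiff : DifferentiableOn ℝ E (interior (Set.Ici 0)) := fun t ht =>
    (hderiv t (interior_subset ht)).differentiableAt.differentiableWithinAt
  have hle : ∀ t, 0 ≤ t → E t ≤ E 0 := by
    refine fun t ht => antitoneOn_of_deriv_nonpos (convex_Ici 0) hcont hdiff (fun s hs => ?_)
      Set.self_mem_Ici ht ht
    rw [(hderiv s (interior_subset hs)).deriv]
    have h1 : 0 ≤ (Btil n *ᵥ hv s) ⬝ᵥ (Btil n *ᵥ hv s) :=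
      Finset.sum_nonneg fun i _ => mul_self_nonneg _
    have h2 : 0 ≤ (Btil n *ᵥ uv s) ⬝ᵥ (Btil n *ᵥ uv s) :=
      Finset.sum_nonneg fun i _ => mul_self_nonneg _
    have h3 := mul_nonneg (mul_nonneg hg.le hαh) h1
    have h4 := mul_nonneg (mul_nonneg hH.le hαu) h2
    linarith
  refine ⟨hle, fun hαh0 hαu0 t ht => (hle t ht).antisymm ?_⟩
  refine monotoneOn_of_deriv_nonneg (convex_Ici 0) hcont hdiff (fun s hs => ?_)
    Set.self_mem_Ici ht ht
  rw [(hderiv s (interior_subset hs)).deriv, hαh0, hαu0]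
  simp
end
end

section
/- Let g, H > 0 and U ∈ ℝ. Let A be the symmetric 5×5 real matrix with rows [−gU/2, −gH/2, 0, 0, 0], [−gH/2, −HU/2, 0, H³U/6, H³/6], [0, 0, −H³U/6, 0, 0], [0, H³U/6, 0, 0, 0], [0, H³/6, 0, 0, 0], and let P be the 5×5 matrix equal to the identity except for the entries P₁₅ = 3g/H² and P₄₅ = −U. Then: (i) P·A·Pᵀ equals the symmetric matrix with rows [−gU/2, 0, 0, 0, 0], [0, −HU/2, 0, 0, H³/6], [0, 0, −H³U/6, 0, 0], [0, 0, 0, 0, 0], [0, H³/6, 0, 0, 0]; and (ii) the eigenvalues of P·A·Pᵀ are exactly 0, −H³U/6, −gU/2, −HU/4 − (H/12)·√(4H⁴ + 9U²), and −HU/4 + (H/12)·√(4H⁴ + 9U²); equivalently, the characteristic polynomial of P·A·Pᵀ is det(x·I − P·A·Pᵀ) = x·(x + H³U/6)·(x + gU/2)·(x + HU/4 + (H/12)√(4H⁴+9U²))·(x + HU/4 − (H/12)√(4H⁴+9U²)). -/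
open Matrix

/-- The characteristic determinant of a matrix that is diagonal apart from a symmetric
coupling `e` between the second and the last coordinate. -/
lemma det_smul_one_sub_of_coupled (a b c e x : ℝ) :
    (x • (1 : Matrix (Fin 5) (Fin 5) ℝ) -
      !![a, 0, 0, 0, 0;
        0, b, 0, 0, e;
        0, 0, c, 0, 0;
        0, 0, 0, 0, 0;
        0, e, 0, 0, 0]).det = x * (x - c) * (x - a) * (x * (x - b) - e ^ 2) := by
  have h : x • (1 : Matrix (Fin 5) (Fin 5) ℝ) -
      !![a, 0, 0, 0, 0;
        0, b, 0, 0, e;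
        0, 0, c, 0, 0;
        0, 0, 0, 0, 0;
        0, e, 0, 0, 0] =
      !![x - a, 0, 0, 0, 0;
        0, x - b, 0, 0, -e;
        0, 0, x - c, 0, 0;
        0, 0, 0, x, 0;
        0, -e, 0, 0, x] := by
    ext i j
    fin_cases i <;> fin_cases j <;> simp
  rw [h]
  simp [Matrix.det_succ_row_zero, Fin.sum_univ_succ, Fin.succAbove]
  ring

/-- Appendix A: the congruence transformation and eigen-decomposition of the
boundary-term matrix `A` of the linearized Serre equations. -/
theorem boundary_matrix_eigendecomposition (g H U : ℝ) (hg : 0 < g) (hH : 0 < H) :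
    (!![(1 : ℝ), 0, 0, 0, 3 * g / H ^ 2;
        0, 1, 0, 0, 0;
        0, 0, 1, 0, 0;
        0, 0, 0, 1, -U;
        0, 0, 0, 0, 1] *
      !![-(g * U) / 2, -(g * H) / 2, 0, 0, 0;
        -(g * H) / 2, -(H * U) / 2, 0, H ^ 3 * U / 6, H ^ 3 / 6;
        0, 0, -(H ^ 3 * U) / 6, 0, 0;
        0, H ^ 3 * U / 6, 0, 0, 0;
        0, H ^ 3 / 6, 0, 0, 0] *
      (!![(1 : ℝ), 0, 0, 0, 3 * g / H ^ 2;
        0, 1, 0, 0, 0;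
        0, 0, 1, 0, 0;
        0, 0, 0, 1, -U;
        0, 0, 0, 0, 1])ᵀ
      = !![-(g * U) / 2, 0, 0, 0, 0;
          0, -(H * U) / 2, 0, 0, H ^ 3 / 6;
          0, 0, -(H ^ 3 * U) / 6, 0, 0;
          0, 0, 0, 0, 0;
          0, H ^ 3 / 6, 0, 0, 0]) ∧
    (∀ x : ℝ,
      (x • (1 : Matrix (Fin 5) (Fin 5) ℝ) -
        !![(1 : ℝ), 0, 0, 0, 3 * g / H ^ 2;
          0, 1, 0, 0, 0;
          0, 0, 1, 0, 0;
          0, 0, 0, 1, -U;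
          0, 0, 0, 0, 1] *
        !![-(g * U) / 2, -(g * H) / 2, 0, 0, 0;
          -(g * H) / 2, -(H * U) / 2, 0, H ^ 3 * U / 6, H ^ 3 / 6;
          0, 0, -(H ^ 3 * U) / 6, 0, 0;
          0, H ^ 3 * U / 6, 0, 0, 0;
          0, H ^ 3 / 6, 0, 0, 0] *
        (!![(1 : ℝ), 0, 0, 0, 3 * g / H ^ 2;
          0, 1, 0, 0, 0;
          0, 0, 1, 0, 0;
          0, 0, 0, 1, -U;
          0, 0, 0, 0, 1])ᵀ).det
        = x * (x + H ^ 3 * U / 6) * (x + g * U / 2)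
            * (x + H * U / 4 + H / 12 * Real.sqrt (4 * H ^ 4 + 9 * U ^ 2))
            * (x + H * U / 4 - H / 12 * Real.sqrt (4 * H ^ 4 + 9 * U ^ 2))) := by
  rw [and_iff_left_of_imp]
  · ext i j
    fin_cases i <;> fin_cases j <;>
      simp [Matrix.mul_apply, Fin.sum_univ_succ] <;> field_simp <;> ring
  · intro h x
    rw [h, det_smul_one_sub_of_coupled]
    have hs : Real.sqrt (4 * H ^ 4 + 9 * U ^ 2) ^ 2 = 4 * H ^ 4 + 9 * U ^ 2 :=
      Real.sq_sqrt (by positivity)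
    linear_combination (x * (x + H ^ 3 * U / 6) * (x + g * U / 2) * H ^ 2 / 144) * hs
end
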